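/- arXiv:2302.12849 — 3 statements merged into one kernel-verified Lean document; each statement's English description precedes it below -/
import Mathlib

section
/- Generalized Riemann–Lebesgue lemma: let h ∈ L¹(Ω̂, det M̂(P) d³P) and assume supp(h) satisfies the A-nondegeneracy condition. Then for every k ∈ ℤ³ \ {0}, ∫_{Ω̂} h(P) e^{−i t k·ω(P)} det M̂(P) d³P → 0 as t → ∞. -/
open MeasureTheory Real Filter Topology Set
open scoped ENNReal

noncomputable section

/-- The space of the integrals of motion `P ∈ ℝ³`. -/
abbrev Param : Type := Fin 3 → ℝ

/-- The weighted measure `det M̂(P) d³P` on `Ω̂ ⊆ ℝ³`. -/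
def weightedMeasure (Ω : Set Param) (M : Param → Matrix (Fin 3) (Fin 3) ℝ) :
    Measure Param :=
  ((volume : Measure Param).restrict Ω).withDensity fun P => ENNReal.ofReal (M P).det

open scoped FourierTransform

section Oscillatory

variable {E F : Type*} [NormedAddCommGroup E] [NormedSpace ℝ E] [FiniteDimensional ℝ E]
  [MeasurableSpace E] [BorelSpace E] [NormedAddCommGroup F] [NormedSpace ℂ F]

/-- The **Riemann-Lebesgue lemma** for a phase that is injective with invertible derivative. -/
theorem tendsto_setIntegral_exp_comp_cocompact_of_injOn (μ : Measure E) [μ.IsAddHaarMeasure]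
    {s : Set E} {f : E → E} {f' : E → E →L[ℝ] E} (hs : MeasurableSet s)
    (hf' : ∀ x ∈ s, HasFDerivWithinAt f (f' x) s x) (hdet : ∀ x ∈ s, (f' x).det ≠ 0)
    (hf : InjOn f s) (g : E → F) :
    Tendsto (fun w : StrongDual ℝ E => ∫ x in s, 𝐞 (-w (f x)) • g x ∂μ)
      (cocompact (StrongDual ℝ E)) (𝓝 0) := by
  have him : MeasurableSet (f '' s) := measurable_image_of_fderivWithin hs hf' hf
  let G : E → F := fun y => |(f' (Function.invFunOn f s y)).det|⁻¹ • g (Function.invFunOn f s y)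
  refine (tendsto_integral_exp_smul_cocompact ((f '' s).indicator G) μ).congr fun w => ?_
  calc ∫ y, 𝐞 (-w y) • (f '' s).indicator G y ∂μ
      = ∫ y in f '' s, 𝐞 (-w y) • G y ∂μ := by
        rw [← integral_indicator him]
        exact integral_congr_ae (.of_forall fun y =>
          (indicator_smul_apply (f '' s) (fun y => 𝐞 (-w y)) G y).symm)
    _ = ∫ x in s, |(f' x).det| • 𝐞 (-w (f x)) • G (f x) ∂μ :=
        integral_image_eq_integral_abs_det_fderiv_smul μ hs hf' hf _
    _ = ∫ x in s, 𝐞 (-w (f x)) • g x ∂μ := by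
        refine setIntegral_congr_fun hs fun x hx => ?_
        simp only [G, hf.leftInvOn_invFunOn hx]
        rw [smul_comm (𝐞 _), smul_inv_smul₀ (abs_ne_zero.2 (hdet x hx))]

/-- A set on which `f` has invertible derivatives splits into countably many disjoint measurable
pieces on which `f` is injective. -/
theorem exists_partition_injOn_of_hasFDerivWithinAt
    {s : Set E} {f : E → E} {f' : E → E →L[ℝ] E}
    (hf' : ∀ x ∈ s, HasFDerivWithinAt f (f' x) s x) (hdet : ∀ x ∈ s, (f' x).det ≠ 0) :
    ∃ t : ℕ → Set E, Pairwise (Function.onFun Disjoint t) ∧ (∀ n, MeasurableSet (t n)) ∧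
      s ⊆ ⋃ n, t n ∧ ∀ n, InjOn f (s ∩ t n) := by
  have key : ∀ A : E →L[ℝ] E, ∃ δ : NNReal, δ ≠ 0 ∧ (A.det ≠ 0 →
      ∀ u : Set E, ApproximatesLinearOn f A u δ → InjOn f u) := by
    intro A
    by_cases hA : A.det = 0
    · exact ⟨1, one_ne_zero, fun h => absurd hA h⟩
    let B := A.toContinuousLinearEquivOfDetNeZero hA
    rcases B.subsingleton_or_nnnorm_symm_pos with hE | hB
    · exact ⟨1, one_ne_zero, fun _ u _ => (Function.injective_of_subsingleton f).injOn⟩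
    · obtain ⟨δ, hδ, hδB⟩ := exists_between (inv_pos.2 hB)
      exact ⟨δ, hδ.ne', fun _ u hu =>
        ApproximatesLinearOn.injOn (f' := B) hu (Or.inr hδB)⟩
  choose r hr hinj using key
  obtain ⟨t, A, hdisj, hmeas, hcov, happ, hA⟩ :=
    exists_partition_approximatesLinearOn_of_hasFDerivWithinAt f s f' hf' r hr
  refine ⟨t, hdisj, hmeas, hcov, fun n => ?_⟩
  rcases s.eq_empty_or_nonempty with rfl | hne
  · simp
  obtain ⟨y, hy, hyA⟩ := hA hne n
  exact hinj (A n) (hyA ▸ hdet y hy) _ (happ n)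

/-- The **Riemann-Lebesgue lemma** for a phase with invertible derivative. -/
theorem tendsto_setIntegral_exp_comp_cocompact [CompleteSpace F] (μ : Measure E)
    [μ.IsAddHaarMeasure]
    {s : Set E} {f : E → E} {f' : E → E →L[ℝ] E} (hs : MeasurableSet s)
    (hf' : ∀ x ∈ s, HasFDerivWithinAt f (f' x) s x) (hdet : ∀ x ∈ s, (f' x).det ≠ 0)
    {g : E → F} (hg : IntegrableOn g s μ) :
    Tendsto (fun w : StrongDual ℝ E => ∫ x in s, 𝐞 (-w (f x)) • g x ∂μ)
      (cocompact (StrongDual ℝ E)) (𝓝 0) := by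
  obtain ⟨t, hdisj, hmeas, hcov, hinj⟩ := exists_partition_injOn_of_hasFDerivWithinAt hf' hdet
  have hsU : ⋃ n, s ∩ t n = s := by rw [← inter_iUnion, inter_eq_left.2 hcov]
  have hm : ∀ n, MeasurableSet (s ∩ t n) := fun n => hs.inter (hmeas n)
  have hd : Pairwise (Function.onFun Disjoint fun n => s ∩ t n) := fun i j hij =>
    (hdisj hij).mono inter_subset_right inter_subset_right
  have hfc : ContinuousOn f s := fun x hx => (hf' x hx).continuousWithinAt
  have hint : ∀ w : StrongDual ℝ E, IntegrableOn (fun x => 𝐞 (-w (f x)) • g x) s μ := by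
    intro w
    refine Integrable.mono hg ?_ (.of_forall fun x => (Circle.norm_smul _ _).le)
    have hc : ContinuousOn (fun x => (𝐞 (-w (f x)) : ℂ)) s := by
      have : Continuous fun y => (𝐞 (-w y) : ℂ) := by fun_prop
      exact this.comp_continuousOn hfc
    exact (hc.aestronglyMeasurable hs).smul hg.aestronglyMeasurable
  have hsum : ∀ w : StrongDual ℝ E,
      ∑' n, ∫ x in s ∩ t n, 𝐞 (-w (f x)) • g x ∂μ = ∫ x in s, 𝐞 (-w (f x)) • g x ∂μ := by
    intro w
    conv_rhs => rw [← hsU]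
    exact (integral_iUnion hm hd (by rw [hsU]; exact hint w)).symm
  have hbound : Summable fun n => ∫ x in s ∩ t n, ‖g x‖ ∂μ :=
    (hasSum_integral_iUnion hm hd (by rw [hsU]; exact hg.norm)).summable
  have hlim := tendsto_tsum_of_dominated_convergence hbound
    (fun n => tendsto_setIntegral_exp_comp_cocompact_of_injOn μ (hm n)
      (fun x hx => (hf' x hx.1).mono inter_subset_left) (fun x hx => hdet x hx.1) (hinj n) g)
    (.of_forall fun w n => (norm_integral_le_integral_norm _).trans_eq
      (by simp only [Circle.norm_smul]))
  simpa only [hsum, tsum_zero] using hlim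

end Oscillatory

/-- Generalized Riemann–Lebesgue lemma: if `h ∈ L¹(Ω̂, det M̂(P) d³P)` and
`supp(h)` satisfies the A-nondegeneracy condition, then for every
`k ∈ ℤ³ \ {0}` one has `∫_{Ω̂} h(P) e^{−i t k·ω(P)} det M̂(P) d³P → 0`
as `t → ∞`. -/
theorem generalized_Riemann_Lebesgue
    (Ω : Set Param) (hΩ : IsOpen Ω)
    (M : Param → Matrix (Fin 3) (Fin 3) ℝ)
    (hMcont : ContinuousOn M Ω) (hMdet : ∀ P ∈ Ω, 0 < (M P).det)
    (ω : Param → Param) (hω : ContDiffOn ℝ 1 ω Ω)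
    (h : Param → ℂ) (hh : Integrable h (weightedMeasure Ω M))
    (hA : volume ({P | P ∈ Ω ∧ (fderiv ℝ ω P).det = 0} ∩ tsupport h) = 0)
    (k : Fin 3 → ℤ) (hk : k ≠ 0) :
    Tendsto
      (fun t : ℝ => ∫ P, h P *
        Complex.exp (-(Complex.I * (t : ℂ) * ((∑ i, (k i : ℝ) * ω P i : ℝ) : ℂ)))
        ∂(weightedMeasure Ω M))
      atTop (𝓝 0) := by
  let A : Set Param := {P | P ∈ Ω ∧ (fderiv ℝ ω P).det ≠ 0}
  have hAΩ : A ⊆ Ω := fun P hP => hP.1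
  have hdetc : ContinuousOn (fun P => (fderiv ℝ ω P).det) Ω :=
    ContinuousLinearMap.continuous_det.comp_continuousOn
      (hω.continuousOn_fderiv_of_isOpen hΩ le_rfl)
  have hAm : MeasurableSet A := (hdetc.isOpen_inter_preimage hΩ isOpen_ne).measurableSet
  have hdens : AEMeasurable (fun P => ENNReal.ofReal (M P).det) (volume.restrict Ω) :=
    ((Continuous.matrix_det continuous_id).comp_continuousOn hMcont
      |>.aemeasurable hΩ.measurableSet).ennreal_ofReal
  have hfin : ∀ᵐ P ∂(volume.restrict Ω), ENNReal.ofReal (M P).det < ∞ :=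
    .of_forall fun P => ENNReal.ofReal_lt_top
  let g : Param → ℂ := fun P => (ENNReal.ofReal (M P).det).toReal • h P
  have hg : IntegrableOn g Ω := (integrable_withDensity_iff_integrable_smul₀' hdens hfin).1 hh
  have hzero : ∀ᵐ P : Param, P ∈ Ω \ A → h P = 0 := by
    filter_upwards [measure_eq_zero_iff_ae_notMem.1 hA] with P hP hPΩ
    by_contra hne
    exact hP ⟨⟨hPΩ.1, not_not.1 fun hd => hPΩ.2 ⟨hPΩ.1, hd⟩⟩, subset_tsupport h hne⟩
  let L : StrongDual ℝ Param := ∑ i, (k i : ℝ) • ContinuousLinearMap.proj i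
  have hL (y : Param) : L y = ∑ i, (k i : ℝ) * y i := by simp [L]
  have hL0 : L ≠ 0 := by
    obtain ⟨i, hi⟩ := Function.ne_iff.1 hk
    intro h0
    have := hL (Pi.single i 1)
    simp [h0, Pi.single_apply] at this
    exact hi (by simpa using this.symm)
  have hw : Tendsto (fun t : ℝ => (t / (2 * π)) • L) atTop (cocompact (StrongDual ℝ Param)) := by
    rw [← Metric.cobounded_eq_cocompact, ← tendsto_norm_atTop_iff_cobounded]
    simp only [norm_smul]
    exact (tendsto_norm_atTop_atTop.comp
      (tendsto_id.atTop_div_const (by positivity))).atTop_mul_const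
      (norm_pos_iff.2 hL0)
  have hlim := (tendsto_setIntegral_exp_comp_cocompact volume hAm
    (fun P hP => ((hω.differentiableOn one_ne_zero).differentiableAt
      (hΩ.mem_nhds hP.1)).hasFDerivAt.hasFDerivWithinAt)
    (fun P hP => hP.2) (hg.mono_set hAΩ)).comp hw
  refine hlim.congr fun t => ?_
  have hexp (P : Param) : (𝐞 (-((t / (2 * π)) • L) (ω P)) : ℂ) =
      Complex.exp (-(Complex.I * (t : ℂ) * ((∑ i, (k i : ℝ) * ω P i : ℝ) : ℂ))) := by
    rw [Real.fourierChar_apply, ← hL]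
    congr 1
    have : (π : ℂ) ≠ 0 := by exact_mod_cast Real.pi_ne_zero
    simp only [smul_apply, smul_eq_mul]
    push_cast
    field_simp
  rw [weightedMeasure, integral_withDensity_eq_integral_toReal_smul₀ hdens hfin]
  simp only [Function.comp_apply, Circle.smul_def, hexp]
  rw [setIntegral_eq_of_subset_of_ae_sdiff_eq_zero hΩ.measurableSet.nullMeasurableSet hAΩ]
  · refine integral_congr_ae (.of_forall fun P => ?_)
    simp only [g, smul_eq_mul, Complex.real_smul]
    ring
  · filter_upwards [hzero] with P hP hPΩ
    simp [hP hPΩ]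

end
end

section
/- Let m > 0, E, L_z ∈ ℝ, L ≥ 0, and let z = (t,r,ϑ,φ; p_t,p_r,p_ϑ,p_φ) ∈ 𝒰 with r > r₋ and 0 < ϑ < π satisfy the constraints F₀(z) = m²/2, F₁(z) = E, F₂(z) = L_z, F₃(z) = L². Then the gradients in ℝ⁸ of F₀, F₁, F₂, F₃ at z are linearly independent, unless at least one of the following two cases occurs: (a) p_ϑ = 0 and K′(ϑ) = 0; (b) r > r₊ and R(r) = R′(r) = 0. -/
open Real

noncomputable section

/-- Phase space points `z = (t,r,ϑ,φ; p_t,p_r,p_ϑ,p_φ)`, with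
`x^μ = z 0, z 1, z 2, z 3` and `p_μ = z 4, z 5, z 6, z 7`. -/
abbrev Phase : Type := Fin 8 → ℝ

/-- The free-particle Hamiltonian of the Kerr metric in horizon-penetrating
coordinates. -/
def KerrH (MH aH : ℝ) (z : Phase) : ℝ :=
  (1 / (2 * ((z 1) ^ 2 + aH ^ 2 * Real.cos (z 2) ^ 2))) *
    (-(((z 1) ^ 2 + aH ^ 2 * Real.cos (z 2) ^ 2) + 2 * MH * z 1) * (z 4) ^ 2
      + 4 * MH * z 1 * z 4 * z 5 + 2 * aH * z 5 * z 7
      + ((z 1) ^ 2 - 2 * MH * z 1 + aH ^ 2) * (z 5) ^ 2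
      + (z 6) ^ 2 + (z 7) ^ 2 / Real.sin (z 2) ^ 2)

/-- The four integrals of motion `F₀ = −H`, `F₁ = −p_t`, `F₂ = p_φ` and
`F₃` (the Carter constant). -/
def KerrF (MH aH : ℝ) : Fin 4 → Phase → ℝ :=
  ![fun z => -KerrH MH aH z,
    fun z => -(z 4),
    fun z => z 7,
    fun z => (z 6) ^ 2 + (z 7 / Real.sin (z 2) + aH * Real.sin (z 2) * z 4) ^ 2
      - 2 * aH ^ 2 * Real.cos (z 2) ^ 2 * KerrH MH aH z]

/-- The polar effective potential
`K(ϑ) = (L_z/sinϑ − a_H E sinϑ)² + m² a_H² cos²ϑ`. -/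
def Kpol (aH m E Lz : ℝ) (ϑ : ℝ) : ℝ :=
  (Lz / Real.sin ϑ - aH * E * Real.sin ϑ) ^ 2 + m ^ 2 * aH ^ 2 * Real.cos ϑ ^ 2

/-- The radial polynomial `R(r) = [E(r²+a_H²) − a_H L_z]² − Δ(r)(L² + m²r²)`. -/
def Rpol (MH aH m E Lz L : ℝ) (r : ℝ) : ℝ :=
  (E * (r ^ 2 + aH ^ 2) - aH * Lz) ^ 2
    - (r ^ 2 - 2 * MH * r + aH ^ 2) * (L ^ 2 + m ^ 2 * r ^ 2)

/-- The radial part `2r²H − F₃` of the separated Hamiltonian. -/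
def KerrRadial (MH aH pt pφ r pr : ℝ) : ℝ :=
  -(r ^ 2 + aH ^ 2 + 2 * MH * r) * pt ^ 2 + 4 * MH * r * pt * pr + 2 * aH * pr * pφ
    + (r ^ 2 - 2 * MH * r + aH ^ 2) * pr ^ 2 - 2 * aH * pφ * pt

lemma KerrF_three_eq_polar (MH aH m : ℝ) (w : Phase) :
    KerrF MH aH 3 w = (w 6) ^ 2 + Kpol aH m (-(w 4)) (w 7) (w 2)
      + aH ^ 2 * Real.cos (w 2) ^ 2 * (2 * KerrF MH aH 0 w - m ^ 2) := by
  simp only [KerrF, Kpol, Matrix.cons_val]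
  ring

lemma KerrF_three_eq_radial (MH aH : ℝ) (w : Phase) (hr : w 1 ≠ 0)
    (hs : Real.sin (w 2) ≠ 0) :
    KerrF MH aH 3 w = -2 * (w 1) ^ 2 * KerrF MH aH 0 w
      - KerrRadial MH aH (w 4) (w 7) (w 1) (w 5) := by
  have hρ : (w 1) ^ 2 + aH ^ 2 * Real.cos (w 2) ^ 2 ≠ 0 := by positivity
  simp only [KerrF, KerrH, KerrRadial, Matrix.cons_val]
  field_simp
  linear_combination (aH ^ 2 * w 4 ^ 2 * Real.sin (w 2) ^ 2 *
    ((w 1) ^ 2 + aH ^ 2 * Real.cos (w 2) ^ 2)) * Real.sin_sq_add_cos_sq (w 2)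

lemma differentiableAt_KerrF (MH aH : ℝ) (w : Phase) (hr : w 1 ≠ 0)
    (hs : Real.sin (w 2) ≠ 0) (i : Fin 4) : DifferentiableAt ℝ (KerrF MH aH i) w := by
  have hρ : 2 * ((w 1) ^ 2 + aH ^ 2 * Real.cos (w 2) ^ 2) ≠ 0 := by positivity
  have hs2 : Real.sin (w 2) ^ 2 ≠ 0 := pow_ne_zero 2 hs
  have hH : DifferentiableAt ℝ (KerrH MH aH) w := by
    unfold KerrH
    fun_prop (disch := assumption)
  fin_cases i
  · exact hH.neg
  · change DifferentiableAt ℝ (fun z : Phase => -(z 4)) w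
    fun_prop
  · change DifferentiableAt ℝ (fun z : Phase => z 7) w
    fun_prop
  · change DifferentiableAt ℝ (fun z : Phase => (z 6) ^ 2 +
      (z 7 / Real.sin (z 2) + aH * Real.sin (z 2) * z 4) ^ 2
      - 2 * aH ^ 2 * Real.cos (z 2) ^ 2 * KerrH MH aH z) w
    fun_prop (disch := assumption)

lemma hasDerivAt_comp_update {ι : Type*} [Fintype ι] [DecidableEq ι] {f : (ι → ℝ) → ℝ}
    {z : ι → ℝ} (hf : DifferentiableAt ℝ f z) (i : ι) :
    HasDerivAt (fun s => f (Function.update z i s)) (fderiv ℝ f z (Pi.single i 1)) (z i) := by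
  have hu := hasDerivAt_update z i (z i)
  have hf' : HasFDerivAt f (fderiv ℝ f z) (Function.update z i (z i)) := by
    simpa using hf.hasFDerivAt
  exact hf'.comp_hasDerivAt (z i) hu

lemma hasDerivAt_Kpol (aH m E Lz ϑ : ℝ) (hs : Real.sin ϑ ≠ 0) :
    HasDerivAt (Kpol aH m E Lz) (deriv (Kpol aH m E Lz) ϑ) ϑ := by
  refine DifferentiableAt.hasDerivAt ?_
  unfold Kpol
  fun_prop (disch := assumption)

lemma hasDerivAt_Rpol (MH aH m E Lz L r : ℝ) :
    HasDerivAt (Rpol MH aH m E Lz L)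
      (4 * r * E * (E * (r ^ 2 + aH ^ 2) - aH * Lz)
        - (2 * r - 2 * MH) * (L ^ 2 + m ^ 2 * r ^ 2)
        - (r ^ 2 - 2 * MH * r + aH ^ 2) * (2 * m ^ 2 * r)) r := by
  have hid := hasDerivAt_id' r
  have h := (((((hid.pow 2).add_const (aH ^ 2)).const_mul E).sub_const (aH * Lz)).pow 2).sub
    ((((hid.pow 2).sub (hid.const_mul (2 * MH))).add_const (aH ^ 2)).mul
      (((hid.pow 2).const_mul (m ^ 2)).const_add (L ^ 2)))
  refine h.congr_deriv ?_
  simp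
  ring

lemma hasDerivAt_KerrRadial_left (MH aH pt pφ r pr : ℝ) :
    HasDerivAt (fun s => KerrRadial MH aH pt pφ s pr)
      (-(2 * r + 2 * MH) * pt ^ 2 + 4 * MH * pt * pr + (2 * r - 2 * MH) * pr ^ 2) r := by
  have hid := hasDerivAt_id' r
  have h := ((hid.pow 2).const_mul (pr ^ 2 - pt ^ 2)).add
    ((hid.const_mul (-2 * MH * pt ^ 2 + 4 * MH * pt * pr - 2 * MH * pr ^ 2)).add_const
      (-aH ^ 2 * pt ^ 2 + 2 * aH * pr * pφ + aH ^ 2 * pr ^ 2 - 2 * aH * pφ * pt))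
  refine (h.congr_deriv ?_).congr_of_eventuallyEq (Filter.Eventually.of_forall fun s => ?_)
  · simp
    ring
  · simp [KerrRadial]
    ring

lemma hasDerivAt_KerrRadial_right (MH aH pt pφ r pr : ℝ) :
    HasDerivAt (fun s => KerrRadial MH aH pt pφ r s)
      (4 * MH * r * pt + 2 * aH * pφ + 2 * (r ^ 2 - 2 * MH * r + aH ^ 2) * pr) pr := by
  have hid := hasDerivAt_id' pr
  have h := ((hid.pow 2).const_mul (r ^ 2 - 2 * MH * r + aH ^ 2)).add
    ((hid.const_mul (4 * MH * r * pt + 2 * aH * pφ)).add_const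
      (-(r ^ 2 + aH ^ 2 + 2 * MH * r) * pt ^ 2 - 2 * aH * pφ * pt))
  refine (h.congr_deriv ?_).congr_of_eventuallyEq (Filter.Eventually.of_forall fun s => ?_)
  · simp
    ring
  · simp [KerrRadial]
    ring

/-- Double roots of `R` beyond the inner horizon lie outside the outer horizon. -/
lemma outer_horizon_lt_of_Rpol_double_root {MH aH m E Lz L r : ℝ}
    (ha : aH ^ 2 < MH ^ 2) (hm : 0 < m) (hr : MH - √(MH ^ 2 - aH ^ 2) < r) (hr0 : 0 < r)
    (hR : Rpol MH aH m E Lz L r = 0) (hR' : deriv (Rpol MH aH m E Lz L) r = 0) :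
    MH + √(MH ^ 2 - aH ^ 2) < r := by
  rw [(hasDerivAt_Rpol MH aH m E Lz L r).deriv] at hR'
  unfold Rpol at hR
  have hd : 0 < √(MH ^ 2 - aH ^ 2) := Real.sqrt_pos.2 (by linarith)
  have hd2 : √(MH ^ 2 - aH ^ 2) ^ 2 = MH ^ 2 - aH ^ 2 := Real.sq_sqrt (by linarith)
  set d := √(MH ^ 2 - aH ^ 2)
  have hP : 0 < L ^ 2 + m ^ 2 * r ^ 2 := by positivity
  have hΔ : r ^ 2 - 2 * MH * r + aH ^ 2 = (r - (MH - d)) * (r - (MH + d)) := by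
    linear_combination hd2
  by_contra! hle
  rcases hle.lt_or_eq with hlt | rfl
  · have hneg : r ^ 2 - 2 * MH * r + aH ^ 2 < 0 := by
      rw [hΔ]
      exact mul_neg_of_pos_of_neg (by linarith) (by linarith)
    nlinarith [mul_neg_of_neg_of_pos hneg hP, sq_nonneg (E * (r ^ 2 + aH ^ 2) - aH * Lz)]
  · rw [sub_self, mul_zero] at hΔ
    rw [hΔ, zero_mul, sub_zero] at hR
    rw [hΔ, pow_eq_zero_iff two_ne_zero |>.1 hR] at hR'
    nlinarith [mul_pos hd hP]

/-- A critical point of the separated radial Hamiltonian is a double root of `R`. -/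
lemma Rpol_double_root_of_radial_critical {MH aH m L pt pφ r pr : ℝ}
    (hB : L ^ 2 + m ^ 2 * r ^ 2 + KerrRadial MH aH pt pφ r pr = 0)
    (hBr : 2 * m ^ 2 * r + (-(2 * r + 2 * MH) * pt ^ 2 + 4 * MH * pt * pr
      + (2 * r - 2 * MH) * pr ^ 2) = 0)
    (hBp : 4 * MH * r * pt + 2 * aH * pφ + 2 * (r ^ 2 - 2 * MH * r + aH ^ 2) * pr = 0) :
    Rpol MH aH m (-pt) pφ L r = 0 ∧ deriv (Rpol MH aH m (-pt) pφ L) r = 0 := by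
  rw [(hasDerivAt_Rpol MH aH m (-pt) pφ L r).deriv]
  unfold Rpol
  unfold KerrRadial at hB
  have hW : 2 * MH * r * pt + aH * pφ + (r ^ 2 - 2 * MH * r + aH ^ 2) * pr = 0 := by
    linarith
  constructor
  · linear_combination (-(r ^ 2 - 2 * MH * r + aH ^ 2)) * hB
      + (2 * MH * r * pt + aH * pφ + (r ^ 2 - 2 * MH * r + aH ^ 2) * pr) * hW
  · linear_combination (-(2 * r - 2 * MH)) * hB - (r ^ 2 - 2 * MH * r + aH ^ 2) * hBr
      + 2 * (2 * MH * pt + (2 * r - 2 * MH) * pr) * hW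

/-- Let `z ∈ 𝒰` with `r > r₋` and `0 < ϑ < π` satisfy the constraints
`F₀(z) = m²/2`, `F₁(z) = E`, `F₂(z) = L_z`, `F₃(z) = L²`.  Then the gradients
of `F₀,F₁,F₂,F₃` at `z` are linearly independent, unless (a) `p_ϑ = 0` and
`K′(ϑ) = 0`, or (b) `r > r₊` and `R(r) = R′(r) = 0`. -/
theorem KerrF_gradients_linearIndependent (MH aH : ℝ) (hMH : 0 < MH)
    (ha : aH ^ 2 < MH ^ 2)
    (m E Lz L : ℝ) (hm : 0 < m) (hL : 0 ≤ L)
    (z : Phase)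
    (hr : MH - Real.sqrt (MH ^ 2 - aH ^ 2) < z 1)
    (hϑ0 : 0 < z 2) (hϑπ : z 2 < Real.pi)
    (h0 : KerrF MH aH 0 z = m ^ 2 / 2)
    (h1 : KerrF MH aH 1 z = E)
    (h2 : KerrF MH aH 2 z = Lz)
    (h3 : KerrF MH aH 3 z = L ^ 2)
    (hnota : ¬ (z 6 = 0 ∧ deriv (Kpol aH m E Lz) (z 2) = 0))
    (hnotb : ¬ (MH + Real.sqrt (MH ^ 2 - aH ^ 2) < z 1 ∧
        Rpol MH aH m E Lz L (z 1) = 0 ∧ deriv (Rpol MH aH m E Lz L) (z 1) = 0)) :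
    LinearIndependent ℝ (fun a : Fin 4 => fderiv ℝ (KerrF MH aH a) z) := by
  have hd : √(MH ^ 2 - aH ^ 2) ≤ MH :=
    (Real.sqrt_le_left hMH.le).2 (by nlinarith [sq_nonneg aH])
  have hr0 : 0 < z 1 := by linarith
  have hs : Real.sin (z 2) ≠ 0 := (Real.sin_pos_of_pos_of_lt_pi hϑ0 hϑπ).ne'
  have hE : -(z 4) = E := h1
  have hLz : z 7 = Lz := h2
  have hdiff := differentiableAt_KerrF MH aH z hr0.ne' hs
  have hp (a : Fin 4) (i : Fin 8) := hasDerivAt_comp_update (hdiff a) i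
  -- the polar form of `F₃`: its `r` and `p_r` derivatives
  have polar_const (i : Fin 8) (hi : i = 1 ∨ i = 5) :
      fderiv ℝ (KerrF MH aH 3) z (Pi.single i 1)
        = 2 * aH ^ 2 * Real.cos (z 2) ^ 2 * fderiv ℝ (KerrF MH aH 0) z (Pi.single i 1) := by
    refine (hp 3 i).unique ?_
    have h := ((((hp 0 i).const_mul 2).sub_const (m ^ 2)).const_mul
      (aH ^ 2 * Real.cos (z 2) ^ 2)).const_add ((z 6) ^ 2 + Kpol aH m (-(z 4)) (z 7) (z 2))
    refine (h.congr_deriv (by ring)).congr_of_eventuallyEq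
      (Filter.Eventually.of_forall fun s => ?_)
    rcases hi with rfl | rfl <;> simp [KerrF_three_eq_polar MH aH m]
  have polar_mom : fderiv ℝ (KerrF MH aH 3) z (Pi.single 6 1) = 2 * z 6
        + 2 * aH ^ 2 * Real.cos (z 2) ^ 2 * fderiv ℝ (KerrF MH aH 0) z (Pi.single 6 1) := by
    refine (hp 3 6).unique ?_
    have h := (((hasDerivAt_id' (z 6)).pow 2).add_const (Kpol aH m (-(z 4)) (z 7) (z 2))).add
      ((((hp 0 6).const_mul 2).sub_const (m ^ 2)).const_mul (aH ^ 2 * Real.cos (z 2) ^ 2))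
    refine (h.congr_deriv (by simp; ring)).congr_of_eventuallyEq
      (Filter.Eventually.of_forall fun s => ?_)
    simp [KerrF_three_eq_polar MH aH m]
  have polar_pos : fderiv ℝ (KerrF MH aH 3) z (Pi.single 2 1) = deriv (Kpol aH m E Lz) (z 2)
        + 2 * aH ^ 2 * Real.cos (z 2) ^ 2 * fderiv ℝ (KerrF MH aH 0) z (Pi.single 2 1) := by
    refine (hp 3 2).unique ?_
    have h := ((hasDerivAt_Kpol aH m E Lz (z 2) hs).const_add ((z 6) ^ 2)).add
      ((((Real.hasDerivAt_cos (z 2)).pow 2).const_mul (aH ^ 2)).mul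
        (((hp 0 2).const_mul 2).sub_const (m ^ 2)))
    refine (h.congr_deriv ?_).congr_of_eventuallyEq
      (Filter.Eventually.of_forall fun s => ?_)
    · simp [h0]
      ring
    · simp [KerrF_three_eq_polar MH aH m, hE, hLz]
  -- the radial form of `F₃`
  have radial_const (i : Fin 8) (hi : i = 2 ∨ i = 6) :
      fderiv ℝ (KerrF MH aH 3) z (Pi.single i 1)
        = -2 * (z 1) ^ 2 * fderiv ℝ (KerrF MH aH 0) z (Pi.single i 1) := by
    refine (hp 3 i).unique ?_
    have h := ((hp 0 i).const_mul (-2 * (z 1) ^ 2)).sub_const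
      (KerrRadial MH aH (z 4) (z 7) (z 1) (z 5))
    refine h.congr_of_eventuallyEq ?_
    rcases hi with rfl | rfl
    · filter_upwards [Real.continuous_sin.continuousAt.eventually_ne hs] with s hs'
      rw [KerrF_three_eq_radial _ _ _ (by simpa using hr0.ne') (by simpa using hs')]
      simp
    · refine Filter.Eventually.of_forall fun s => ?_
      dsimp only
      rw [KerrF_three_eq_radial _ _ _ (by simpa using hr0.ne') (by simpa using hs)]
      simp
  have radial_mom : fderiv ℝ (KerrF MH aH 3) z (Pi.single 5 1)
        = -2 * (z 1) ^ 2 * fderiv ℝ (KerrF MH aH 0) z (Pi.single 5 1)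
          - (4 * MH * z 1 * z 4 + 2 * aH * z 7
            + 2 * ((z 1) ^ 2 - 2 * MH * z 1 + aH ^ 2) * z 5) := by
    refine (hp 3 5).unique ?_
    have h := ((hp 0 5).const_mul (-2 * (z 1) ^ 2)).sub
      (hasDerivAt_KerrRadial_right MH aH (z 4) (z 7) (z 1) (z 5))
    refine h.congr_of_eventuallyEq (Filter.Eventually.of_forall fun s => ?_)
    dsimp only
    rw [KerrF_three_eq_radial _ _ _ (by simpa using hr0.ne') (by simpa using hs)]
    simp
  have radial_pos : fderiv ℝ (KerrF MH aH 3) z (Pi.single 1 1)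
        = -2 * (z 1) ^ 2 * fderiv ℝ (KerrF MH aH 0) z (Pi.single 1 1)
          - (2 * m ^ 2 * z 1 + (-(2 * z 1 + 2 * MH) * z 4 ^ 2 + 4 * MH * z 4 * z 5
            + (2 * z 1 - 2 * MH) * z 5 ^ 2)) := by
    refine (hp 3 1).unique ?_
    have h := ((((hasDerivAt_id' (z 1)).pow 2).const_mul (-2)).mul (hp 0 1)).sub
      (hasDerivAt_KerrRadial_left MH aH (z 4) (z 7) (z 1) (z 5))
    refine (h.congr_deriv ?_).congr_of_eventuallyEq ?_
    · simp [h0]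
      ring
    · filter_upwards [continuousAt_id.eventually_ne hr0.ne'] with s hs'
      rw [KerrF_three_eq_radial _ _ _ (by simpa using hs') (by simpa using hs)]
      simp
  have hB : L ^ 2 + m ^ 2 * z 1 ^ 2 + KerrRadial MH aH (z 4) (z 7) (z 1) (z 5) = 0 := by
    have h := KerrF_three_eq_radial MH aH z hr0.ne' hs
    rw [h0, h3] at h
    linear_combination h
  have hpolar : ∃ i : Fin 8, (i = 2 ∨ i = 6) ∧
      fderiv ℝ (KerrF MH aH 0) z (Pi.single i 1) ≠ 0 := by
    by_contra! hcon
    have e2 := hcon 2 (.inl rfl)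
    have e6 := hcon 6 (.inr rfl)
    have r2 := radial_const 2 (.inl rfl)
    have r6 := radial_const 6 (.inr rfl)
    rw [polar_pos, e2] at r2
    rw [polar_mom, e6] at r6
    exact hnota ⟨by linarith, by linarith⟩
  have hradial : ∃ i : Fin 8, (i = 1 ∨ i = 5) ∧
      fderiv ℝ (KerrF MH aH 0) z (Pi.single i 1) ≠ 0 := by
    by_contra! hcon
    have e1 := hcon 1 (.inl rfl)
    have e5 := hcon 5 (.inr rfl)
    have r1 := polar_const 1 (.inl rfl)
    have r5 := polar_const 5 (.inr rfl)
    rw [radial_pos, e1] at r1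
    rw [radial_mom, e5] at r5
    obtain ⟨hR, hR'⟩ := Rpol_double_root_of_radial_critical hB (by linarith) (by linarith)
    rw [hE, hLz] at hR hR'
    exact hnotb ⟨outer_horizon_lt_of_Rpol_double_root ha hm hr hr0 hR hR', hR, hR'⟩
  have d1 (i : Fin 8) : fderiv ℝ (KerrF MH aH 1) z (Pi.single i 1)
      = -(Pi.single i 1 : Phase) 4 :=
    congrArg (fun T : Phase →L[ℝ] ℝ => T (Pi.single i 1))
      (hasFDerivAt_apply (𝕜 := ℝ) (4 : Fin 8) z).neg.fderiv
  have d2 (i : Fin 8) : fderiv ℝ (KerrF MH aH 2) z (Pi.single i 1)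
      = (Pi.single i 1 : Phase) 7 :=
    congrArg (fun T : Phase →L[ℝ] ℝ => T (Pi.single i 1))
      (hasFDerivAt_apply (𝕜 := ℝ) (7 : Fin 8) z).fderiv
  rw [Fintype.linearIndependent_iff]
  intro c hc
  have hci (i : Fin 8) : c 0 * fderiv ℝ (KerrF MH aH 0) z (Pi.single i 1)
      - c 1 * (Pi.single i 1 : Phase) 4 + c 2 * (Pi.single i 1 : Phase) 7
      + c 3 * fderiv ℝ (KerrF MH aH 3) z (Pi.single i 1) = 0 := by
    have h := congrArg (fun T : Phase →L[ℝ] ℝ => T (Pi.single i 1)) hc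
    simp only [Fin.sum_univ_four, add_apply, smul_apply, d1, d2,
      smul_eq_mul, zero_apply] at h
    linear_combination h
  have hc03 : c 0 - 2 * z 1 ^ 2 * c 3 = 0 := by
    obtain ⟨i, hi, hne⟩ := hpolar
    have h := hci i
    rw [radial_const i hi] at h
    refine (mul_eq_zero.1
      (?_ : _ * fderiv ℝ (KerrF MH aH 0) z (Pi.single i 1) = 0)).resolve_right hne
    rcases hi with rfl | rfl <;> simp at h <;> linear_combination h
  have hc03' : c 0 + 2 * aH ^ 2 * Real.cos (z 2) ^ 2 * c 3 = 0 := by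
    obtain ⟨i, hi, hne⟩ := hradial
    have h := hci i
    rw [polar_const i hi] at h
    refine (mul_eq_zero.1
      (?_ : _ * fderiv ℝ (KerrF MH aH 0) z (Pi.single i 1) = 0)).resolve_right hne
    rcases hi with rfl | rfl <;> simp at h <;> linear_combination h
  have hρ : (z 1) ^ 2 + aH ^ 2 * Real.cos (z 2) ^ 2 ≠ 0 := by positivity
  have hc3 : c 3 = 0 := by
    refine (mul_eq_zero.1
      (?_ : ((z 1) ^ 2 + aH ^ 2 * Real.cos (z 2) ^ 2) * c 3 = 0)).resolve_left hρ
    linear_combination (hc03' - hc03) / 2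
  have hc0 : c 0 = 0 := by simpa [hc3] using hc03
  have hc1 : c 1 = 0 := by simpa [hc0, hc3] using hci 4
  have hc2 : c 2 = 0 := by simpa [hc0, hc3] using hci 7
  intro j
  fin_cases j <;> assumption

end
end

section
/- (i) If a²(E² − m²) ≤ L_z², then K(ϑ) ≥ L̂_z² for all ϑ ∈ (0,π), with K(π/2) = L̂_z², i.e. K attains its global minimum L̂_z² at ϑ = π/2. (ii) If a²(E² − m²) > L_z² > 0, then K attains its global minimum at exactly the two points ϑ_* and π − ϑ_*, where ϑ_* ∈ (0, π/2) is determined by sin²ϑ_* = |L_z|/(|a|√(E² − m²)), the minimum value being K(ϑ_*) = K(π − ϑ_*) = L̂_z² − (|a|√(E² − m²) − |L_z|)², and ϑ = π/2 is a local maximum of K. -/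
open Real Set

noncomputable section

/-- The polar effective potential
`K(ϑ) = L̂_z² + L_z² cot²ϑ + a²(m² − E²) cos²ϑ`, with `L̂_z = L_z − aE`. -/
def Kpolar (a m E Lz : ℝ) (ϑ : ℝ) : ℝ :=
  (Lz - a * E) ^ 2 + Lz ^ 2 * (Real.cos ϑ / Real.sin ϑ) ^ 2 +
    a ^ 2 * (m ^ 2 - E ^ 2) * Real.cos ϑ ^ 2

theorem Kpolar_eq (a m E Lz : ℝ) {ϑ : ℝ} (h : Real.sin ϑ ≠ 0) :
    Kpolar a m E Lz ϑ = (Lz - a * E) ^ 2 +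
      Real.cos ϑ ^ 2 * (Lz ^ 2 - a ^ 2 * (E ^ 2 - m ^ 2) * Real.sin ϑ ^ 2) / Real.sin ϑ ^ 2 := by
  unfold Kpolar
  field_simp
  ring

/-- Completing the square in `sin² ϑ`. -/
theorem Kpolar_eq_add_sq (a m E Lz A L : ℝ) (hA : A ^ 2 = a ^ 2 * (E ^ 2 - m ^ 2))
    (hL : L ^ 2 = Lz ^ 2) {ϑ : ℝ} (h : Real.sin ϑ ≠ 0) :
    Kpolar a m E Lz ϑ = (Lz - a * E) ^ 2 - (A - L) ^ 2 +
      (A * Real.sin ϑ ^ 2 - L) ^ 2 / Real.sin ϑ ^ 2 := by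
  rw [Kpolar_eq a m E Lz h, ← hA, ← hL, Real.cos_sq']
  field_simp
  ring

theorem Kpolar_pi_div_two (a m E Lz : ℝ) :
    Kpolar a m E Lz (Real.pi / 2) = (Lz - a * E) ^ 2 := by
  simp [Kpolar]

theorem Kpolar_pi_sub (a m E Lz ϑ : ℝ) :
    Kpolar a m E Lz (Real.pi - ϑ) = Kpolar a m E Lz ϑ := by
  simp [Kpolar, Real.cos_pi_sub, Real.sin_pi_sub, neg_div]

theorem isLocalMax_Kpolar_pi_div_two (a m E Lz : ℝ)
    (h : Lz ^ 2 < a ^ 2 * (E ^ 2 - m ^ 2)) :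
    IsLocalMax (Kpolar a m E Lz) (Real.pi / 2) := by
  have h₁ : ∀ᶠ ϑ in nhds (Real.pi / 2), 0 < Real.sin ϑ :=
    Real.continuous_sin.continuousAt.eventually (lt_mem_nhds (by simp))
  have h₂ : ∀ᶠ ϑ in nhds (Real.pi / 2),
      Lz ^ 2 < a ^ 2 * (E ^ 2 - m ^ 2) * Real.sin ϑ ^ 2 :=
    (show ContinuousAt (fun ϑ => a ^ 2 * (E ^ 2 - m ^ 2) * Real.sin ϑ ^ 2) (Real.pi / 2) by
      fun_prop).eventually (lt_mem_nhds (by simpa using h))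
  filter_upwards [h₁, h₂] with ϑ hs hϑ
  rw [Kpolar_pi_div_two, Kpolar_eq a m E Lz hs.ne', add_le_iff_nonpos_right]
  exact div_nonpos_of_nonpos_of_nonneg
    (mul_nonpos_of_nonneg_of_nonpos (sq_nonneg _) (by linarith)) (sq_nonneg _)

theorem eq_or_eq_pi_sub_of_sin_eq {x y : ℝ} (hx : 0 < x) (hx' : x < Real.pi) (hy : 0 < y)
    (hy' : y < Real.pi / 2) (h : Real.sin x = Real.sin y) : x = y ∨ x = Real.pi - y := by
  rcases le_total x (Real.pi / 2) with hle | hle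
  · exact .inl (Real.injOn_sin ⟨by linarith, hle⟩ ⟨by linarith, hy'.le⟩ h)
  · have : Real.pi - x = y :=
      Real.injOn_sin ⟨by linarith, by linarith⟩ ⟨by linarith, hy'.le⟩
        (by rw [Real.sin_pi_sub, h])
    exact .inr (by linarith)

/-- (i) If `a²(E² − m²) ≤ L_z²`, then `K` attains its global minimum `L̂_z²`
at `ϑ = π/2`.  (ii) If `a²(E² − m²) > L_z² > 0`, then `K` attains its global
minimum at exactly the two points `ϑ_*` and `π − ϑ_*`, where
`sin²ϑ_* = |L_z|/(|a|√(E² − m²))`, the minimum value being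
`L̂_z² − (|a|√(E² − m²) − |L_z|)²`, and `ϑ = π/2` is a local maximum of `K`. -/
theorem Kpolar_minima (a m E Lz : ℝ) :
    (a ^ 2 * (E ^ 2 - m ^ 2) ≤ Lz ^ 2 →
      (∀ ϑ : ℝ, 0 < ϑ → ϑ < Real.pi → (Lz - a * E) ^ 2 ≤ Kpolar a m E Lz ϑ) ∧
      Kpolar a m E Lz (Real.pi / 2) = (Lz - a * E) ^ 2) ∧
    (Lz ^ 2 < a ^ 2 * (E ^ 2 - m ^ 2) → 0 < Lz ^ 2 →
      ∃ ϑs : ℝ, 0 < ϑs ∧ ϑs < Real.pi / 2 ∧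
        Real.sin ϑs ^ 2 = |Lz| / (|a| * Real.sqrt (E ^ 2 - m ^ 2)) ∧
        Kpolar a m E Lz ϑs =
          (Lz - a * E) ^ 2 - (|a| * Real.sqrt (E ^ 2 - m ^ 2) - |Lz|) ^ 2 ∧
        Kpolar a m E Lz (Real.pi - ϑs) = Kpolar a m E Lz ϑs ∧
        (∀ ϑ : ℝ, 0 < ϑ → ϑ < Real.pi →
          Kpolar a m E Lz ϑs ≤ Kpolar a m E Lz ϑ) ∧
        (∀ ϑ : ℝ, 0 < ϑ → ϑ < Real.pi →
          Kpolar a m E Lz ϑ = Kpolar a m E Lz ϑs → ϑ = ϑs ∨ ϑ = Real.pi - ϑs) ∧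
        IsLocalMax (Kpolar a m E Lz) (Real.pi / 2)) := by
  refine ⟨fun h => ⟨fun ϑ h0 hpi => ?_, Kpolar_pi_div_two a m E Lz⟩, fun h hL => ?_⟩
  · have hs := Real.sin_pos_of_pos_of_lt_pi h0 hpi
    rw [Kpolar_eq a m E Lz hs.ne', le_add_iff_nonneg_right]
    have key : a ^ 2 * (E ^ 2 - m ^ 2) * Real.sin ϑ ^ 2 ≤ Lz ^ 2 := by
      nlinarith [mul_le_mul_of_nonneg_right h (sq_nonneg (Real.sin ϑ)),
        mul_nonneg (sq_nonneg Lz) (sub_nonneg.2 (Real.sin_sq_le_one ϑ))]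
    exact div_nonneg (mul_nonneg (sq_nonneg _) (by linarith)) (sq_nonneg _)
  · have hB : 0 ≤ E ^ 2 - m ^ 2 := (pos_of_mul_pos_right (hL.trans h) (sq_nonneg a)).le
    set A := |a| * Real.sqrt (E ^ 2 - m ^ 2) with hAdef
    have hA : A ^ 2 = a ^ 2 * (E ^ 2 - m ^ 2) := by
      rw [hAdef, mul_pow, sq_abs, Real.sq_sqrt hB]
    have hL0 : 0 < |Lz| := abs_pos.2 (by rintro rfl; simp at hL)
    have hlt : |Lz| < A :=
      lt_of_pow_lt_pow_left₀ 2 (by positivity) (by rw [sq_abs, hA]; exact h)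
    have hA0 : 0 < A := hL0.trans hlt
    set q := |Lz| / A with hq
    have hq0 : 0 < q := by positivity
    have hq1 : q < 1 := (div_lt_one hA0).2 hlt
    have hK {ϑ : ℝ} (h0 : 0 < ϑ) (hpi : ϑ < Real.pi) :=
      Kpolar_eq_add_sq a m E Lz A |Lz| hA (sq_abs Lz)
        (Real.sin_pos_of_pos_of_lt_pi h0 hpi).ne'
    have hsin : Real.sin (Real.arcsin (Real.sqrt q)) = Real.sqrt q :=
      Real.sin_arcsin (by linarith [Real.sqrt_nonneg q]) (Real.sqrt_le_one.2 hq1.le)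
    have hs0 : 0 < Real.arcsin (Real.sqrt q) := Real.arcsin_pos.2 (Real.sqrt_pos.2 hq0)
    have hs1 : Real.arcsin (Real.sqrt q) < Real.pi / 2 :=
      Real.arcsin_lt_pi_div_two.2 ((Real.sqrt_lt' one_pos).2 (by simpa using hq1))
    generalize Real.arcsin (Real.sqrt q) = ϑs at hsin hs0 hs1
    have hsq : Real.sin ϑs ^ 2 = q := by rw [hsin, Real.sq_sqrt hq0.le]
    have hmin : Kpolar a m E Lz ϑs = (Lz - a * E) ^ 2 - (A - |Lz|) ^ 2 := by
      rw [hK hs0 (by linarith), hsq, hq, mul_div_cancel₀ _ hA0.ne']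
      simp
    refine ⟨ϑs, hs0, hs1, hsq, hmin, Kpolar_pi_sub a m E Lz ϑs, fun ϑ h0 hpi => ?_,
      fun ϑ h0 hpi heq => ?_, isLocalMax_Kpolar_pi_div_two a m E Lz h⟩
    · rw [hmin, hK h0 hpi]
      exact le_add_of_nonneg_right (by positivity)
    · have hs := Real.sin_pos_of_pos_of_lt_pi h0 hpi
      rw [hmin, hK h0 hpi, add_eq_left, div_eq_zero_iff, or_iff_left (pow_pos hs 2).ne',
        sq_eq_zero_iff, sub_eq_zero] at heq
      refine eq_or_eq_pi_sub_of_sin_eq h0 hpi hs0 hs1 ?_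
      rw [hsin, eq_comm, Real.sqrt_eq_iff_eq_sq hq0.le hs.le, hq, div_eq_iff hA0.ne', ← heq,
        mul_comm]

end
end
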